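/- Let 1 < θ < p, fix N ∈ ℕ and points a < h₁ < h₂ < … < h_N < b. There exists ε₀ > 0 such that for every ε ∈ (0, ε₀) there exist two functions φ and −φ, each solving the boundary value problem −ε^p(|u'|^{p−2}u')' + F'(u) = 0 on (a,b) with u'(a) = u'(b) = 0, satisfying |φ(x)| ≤ 1 for all x ∈ [a,b] and having exactly N zeros, located at h₁, …, h_N. Moreover, for every ε ∈ (0, ε₀), E_ε[±φ] = N c_p. -/

import Mathlib

open Set MeasureTheory intervalIntegral Filter Topology

noncomputable def F (θ u : ℝ) : ℝ := (1 / (2 * θ)) * |1 - u ^ 2| ^ θ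

noncomputable def F' (θ u : ℝ) : ℝ := -u * (1 - u ^ 2) * |1 - u ^ 2| ^ (θ - 2)

noncomputable def Eeps (a b p θ ε : ℝ) (u : ℝ → ℝ) : ℝ :=
  ∫ x in a..b, (ε ^ (p - 1) * |deriv u x| ^ p / p + F θ (u x) / ε)

noncomputable def cp (p θ : ℝ) : ℝ :=
  (p / (p - 1)) ^ ((p - 1) / p) * ∫ s in (-1 : ℝ)..1, (F θ s) ^ ((p - 1) / p)

/-- `u` solves the boundary value problem
`-ε^p(|u'|^{p-2}u')' + F'(u) = β` on `(a,b)`, `u'(a) = u'(b) = 0`. -/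
def solvesBVP (a b p θ ε β : ℝ) (u : ℝ → ℝ) : Prop :=
  (∀ x ∈ Set.Ioo a b,
    -(ε ^ p) * deriv (fun y => |deriv u y| ^ (p - 2) * deriv u y) x + F' θ (u x) = β) ∧
  deriv u a = 0 ∧ deriv u b = 0

noncomputable def GG (p θ s : ℝ) : ℝ := (p / (p - 1) * F θ s) ^ (1 / p)

theorem F_nonneg' {θ : ℝ} (hθ : 1 < θ) (s : ℝ) : 0 ≤ F θ s := by
  unfold F; positivity

theorem F_cont {θ : ℝ} (hθ : 1 < θ) : Continuous (F θ) := by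
  unfold F
  refine continuous_const.mul (Continuous.rpow_const (by fun_prop) (fun x => Or.inr (by linarith)))

theorem F_congr {θ u v : ℝ} (h : |u| = |v|) : F θ u = F θ v := by
  unfold F; rw [← sq_abs u, h, sq_abs]

theorem GG_congr {p θ u v : ℝ} (h : |u| = |v|) : GG p θ u = GG p θ v := by
  unfold GG; rw [F_congr h]

theorem F_one {θ u : ℝ} (hθ : 1 < θ) (h : |u| = 1) : F θ u = 0 := by
  unfold F; rw [← sq_abs u, h]; simp; right; exact Real.zero_rpow (by linarith)

theorem GG_one {p θ u : ℝ} (hθ : 1 < θ) (hp : 1 < p) (h : |u| = 1) : GG p θ u = 0 := by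
  unfold GG; rw [F_one hθ h, mul_zero]; exact Real.zero_rpow (by positivity)

theorem GG_cont {p θ : ℝ} (hθ : 1 < θ) (hp : 1 < p) : Continuous (GG p θ) := by
  unfold GG
  exact Continuous.rpow_const (continuous_const.mul (F_cont hθ)) (fun x => Or.inr (by positivity))

theorem GG_nonneg {p θ : ℝ} (hθ : 1 < θ) (hp : 1 < p) (s : ℝ) : 0 ≤ GG p θ s := by
  unfold GG
  have := F_nonneg' hθ s
  have : 0 < p - 1 := by linarith
  positivity

theorem one_sub_sq_pos {s : ℝ} (h : |s| < 1) : 0 < 1 - s ^ 2 := by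
  have := (sq_lt_one_iff_abs_lt_one s).2 h
  linarith

theorem F_pos' {θ s : ℝ} (hθ : 1 < θ) (h : |s| < 1) : 0 < F θ s := by
  have := one_sub_sq_pos h
  unfold F
  have : 0 < |1 - s ^ 2| := abs_pos.2 this.ne'
  positivity

theorem GG_pos {p θ s : ℝ} (hθ : 1 < θ) (hp : 1 < p) (h : |s| < 1) : 0 < GG p θ s := by
  unfold GG
  have := F_pos' hθ h
  have : 0 < p - 1 := by linarith
  positivity

theorem GG_pow {p θ : ℝ} (hθ : 1 < θ) (hp : 1 < p) (s q : ℝ) :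
    (GG p θ s) ^ q = (p / (p - 1) * F θ s) ^ (q / p) := by
  unfold GG
  have := F_nonneg' hθ s
  have : 0 < p - 1 := by linarith
  rw [← Real.rpow_mul (by positivity)]
  congr 1; ring

theorem F_eq {θ s : ℝ} (h : |s| < 1) : F θ s = (1 / (2 * θ)) * (1 - s ^ 2) ^ θ := by
  unfold F; rw [abs_of_pos (one_sub_sq_pos h)]

theorem F_deriv {θ s : ℝ} (hθ : 1 < θ) (h : |s| < 1) : HasDerivAt (F θ) (F' θ s) s := by
  have h1 := one_sub_sq_pos h
  have h2 : HasDerivAt (fun u : ℝ => (1 / (2 * θ)) * (1 - u ^ 2) ^ θ)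
      ((1 / (2 * θ)) * ((-(2 * s)) * θ * (1 - s ^ 2) ^ (θ - 1))) s := by
    refine HasDerivAt.const_mul _ (HasDerivAt.rpow_const ?_ (Or.inl h1.ne'))
    have := (hasDerivAt_pow 2 s).const_sub 1
    simpa using this
  have h3 : F' θ s = (1 / (2 * θ)) * ((-(2 * s)) * θ * (1 - s ^ 2) ^ (θ - 1)) := by
    unfold F'
    rw [abs_of_pos h1, show θ - 1 = 1 + (θ - 2) by ring, Real.rpow_add h1, Real.rpow_one]
    field_simp
  rw [h3]
  refine h2.congr_of_eventuallyEq ?_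
  have : ∀ᶠ u : ℝ in 𝓝 s, |u| < 1 := continuous_abs.continuousAt.eventually (gt_mem_nhds h)
  filter_upwards [this] with u hu using F_eq hu

theorem GGp_deriv {p θ s : ℝ} (hθ : 1 < θ) (hp : 1 < p) (h : |s| < 1) :
    HasDerivAt (fun u => GG p θ u ^ (p - 1)) (F' θ s / GG p θ s) s := by
  have h1 := F_pos' hθ h
  have h0 : 0 < p - 1 := by linarith
  have h2 : 0 < p / (p - 1) * F θ s := by positivity
  have h3 := ((F_deriv hθ h).const_mul (p / (p - 1))).rpow_const (p := (p - 1) / p) (Or.inl h2.ne')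
  have e : (fun u => GG p θ u ^ (p - 1)) = fun u => (p / (p - 1) * F θ u) ^ ((p - 1) / p) := by
    ext u; exact GG_pow hθ hp u _
  rw [e]
  convert h3 using 1
  unfold GG
  rw [show (p - 1) / p - 1 = -(1 / p) by field_simp; ring, Real.rpow_neg h2.le]
  field_simp

theorem F'_eq {θ s : ℝ} (hθ : 1 < θ) (h : |s| ≤ 1) : F' θ s = -s * (1 - s ^ 2) ^ (θ - 1) := by
  have h1 : 0 ≤ 1 - s ^ 2 := by
    have := (sq_le_one_iff_abs_le_one s).2 h
    linarith
  unfold F'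
  rcases h1.eq_or_lt with h2 | h2
  · rw [← h2, Real.zero_rpow (x := θ - 1) (by linarith)]; simp
  · rw [abs_of_pos h2, show θ - 1 = 1 + (θ - 2) by ring, Real.rpow_add h2, Real.rpow_one]; ring

theorem F'_one {θ s : ℝ} (h : |s| = 1) : F' θ s = 0 := by
  unfold F'; rw [← sq_abs, h]; simp

theorem deriv_fill {f g : ℝ → ℝ} (hf : Continuous f) (hg : Continuous g) {s : Set ℝ}
    (hs : s.Countable) (h : ∀ x, x ∉ s → HasDerivAt f (g x) x) (x : ℝ) : HasDerivAt f (g x) x := by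
  have key : ∀ y, f y = f 0 + ∫ t in (0 : ℝ)..y, g t := by
    intro y
    have := MeasureTheory.integral_eq_of_hasDerivAt_off_countable f g hs hf.continuousOn
      (a := 0) (b := y) (fun x hx => h x hx.2) (hg.intervalIntegrable _ _)
    linarith
  have : f = fun y => f 0 + ∫ t in (0 : ℝ)..y, g t := funext key
  rw [this]
  exact (intervalIntegral.integral_hasDerivAt_right (hg.intervalIntegrable _ _)
    (hg.stronglyMeasurableAtFilter _ _) hg.continuousAt).const_add _

noncomputable def gg (p θ t : ℝ) : ℝ := if |t| < 1 then (GG p θ t)⁻¹ else 1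

theorem GG_bound {p θ t : ℝ} (hθ : 1 < θ) (hθp : θ < p) (h : |t| < 1) :
    (GG p θ t)⁻¹ = ((p / (p - 1) * (1 / (2 * θ))) ^ (1 / p))⁻¹ * (1 - t ^ 2) ^ (-(θ / p)) := by
  have h0 : 0 < p - 1 := by linarith
  have hp0 : 0 < p := by linarith
  have h1 := one_sub_sq_pos h
  unfold GG
  rw [F_eq h, ← mul_assoc, Real.mul_rpow (by positivity) (by positivity), ← Real.rpow_mul h1.le,
    mul_inv, ← Real.rpow_neg h1.le]
  congr 2; ring

theorem gg_int {p θ : ℝ} (hθ : 1 < θ) (hθp : θ < p) (x y : ℝ) :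
    IntervalIntegrable (gg p θ) volume x y := by
  have h0 : 0 < p - 1 := by linarith
  have hp : 0 < p := by linarith
  set C := ((p / (p - 1) * (1 / (2 * θ))) ^ (1 / p))⁻¹ with hC
  have hCp : 0 < C := by positivity
  have hα : -1 < -(θ / p) := by
    have : θ / p < 1 := (div_lt_one hp).2 hθp
    linarith
  have i1 : IntervalIntegrable (fun t : ℝ => (1 - t) ^ (-(θ / p))) volume x y := by
    have := (intervalIntegral.intervalIntegrable_rpow' hα (a := 1 - x) (b := 1 - y)).comp_sub_left 1
    simpa using this
  have i2 : IntervalIntegrable (fun t : ℝ => (1 + t) ^ (-(θ / p))) volume x y := by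
    have := (intervalIntegral.intervalIntegrable_rpow' hα (a := 1 + x) (b := 1 + y)).comp_add_left 1
    simpa using this
  have i3 : IntervalIntegrable (fun t : ℝ => 1 + C * (|(1 - t) ^ (-(θ / p))| + |(1 + t) ^ (-(θ / p))|)) volume x y :=
    (intervalIntegrable_const).add ((i1.abs.add i2.abs).const_mul C)
  refine i3.mono_fun ?_ ?_
  · refine Measurable.aestronglyMeasurable ?_
    unfold gg
    refine Measurable.ite ?_ (GG_cont hθ (by linarith)).measurable.inv measurable_const
    exact measurableSet_lt (by fun_prop) (by fun_prop)
  · refine Filter.Eventually.of_forall (fun t => ?_)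
    have hR : 0 ≤ C * (|(1 - t) ^ (-(θ / p))| + |(1 + t) ^ (-(θ / p))|) := by positivity
    simp only [Real.norm_eq_abs]
    rw [abs_of_nonneg (by linarith : 0 ≤ 1 + C * (|(1 - t) ^ (-(θ / p))| + |(1 + t) ^ (-(θ / p))|))]
    unfold gg
    split_ifs with ht
    · rw [GG_bound hθ hθp ht, ← hC, abs_of_nonneg (by have := one_sub_sq_pos ht; positivity)]
      have key : (1 - t ^ 2) ^ (-(θ / p)) ≤ |(1 - t) ^ (-(θ / p))| + |(1 + t) ^ (-(θ / p))| := by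
        have hα2 : -(θ / p) ≤ 0 := by
          have : 0 < θ / p := by positivity
          linarith
        obtain ⟨h1, h2⟩ := abs_lt.1 ht
        rcases le_total 0 t with h3 | h3
        · have := Real.rpow_le_rpow_of_nonpos (by linarith : 0 < 1 - t) (by nlinarith : 1 - t ≤ 1 - t ^ 2) hα2
          have := le_abs_self ((1 - t) ^ (-(θ / p)))
          have := abs_nonneg ((1 + t) ^ (-(θ / p)))
          linarith
        · have := Real.rpow_le_rpow_of_nonpos (by linarith : 0 < 1 + t) (by nlinarith : 1 + t ≤ 1 - t ^ 2) hα2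
          have := le_abs_self ((1 + t) ^ (-(θ / p)))
          have := abs_nonneg ((1 - t) ^ (-(θ / p)))
          linarith
      have := mul_le_mul_of_nonneg_left key hCp.le
      linarith
    · simp; linarith

theorem gg_lower {p θ : ℝ} (hθ : 1 < θ) (hθp : θ < p) : ∃ m > 0, ∀ t, m ≤ gg p θ t := by
  have h0 : 0 < p - 1 := by linarith
  have hp : 0 < p := by linarith
  refine ⟨min 1 ((p / (p - 1) * (1 / (2 * θ))) ^ (1 / p))⁻¹, by positivity, fun t => ?_⟩
  unfold gg
  split_ifs with ht
  · rw [GG_bound hθ hθp ht]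
    refine (min_le_right _ _).trans (le_mul_of_one_le_right (by positivity) ?_)
    refine Real.one_le_rpow_of_pos_of_le_one_of_nonpos (one_sub_sq_pos ht) (by nlinarith [sq_nonneg t]) ?_
    have : 0 < θ / p := by positivity
    linarith
  · exact min_le_left _ _

theorem gg_T {p θ : ℝ} (hθ : 1 < θ) (hθp : θ < p) : ∃ e : ℝ ≃o ℝ, e 0 = 0 ∧
    ∀ s, |s| < 1 → HasDerivAt e (GG p θ s)⁻¹ s := by
  obtain ⟨m, hm, hml⟩ := gg_lower hθ hθp
  have hp : 1 < p := by linarith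
  set T : ℝ → ℝ := fun s => ∫ t in (0 : ℝ)..s, gg p θ t with hT
  have hcont : Continuous T := intervalIntegral.continuous_primitive (gg_int hθ hθp) 0
  have hdiff : ∀ x y, x ≤ y → m * (y - x) ≤ T y - T x := by
    intro x y hxy
    rw [hT]
    simp only
    rw [intervalIntegral.integral_interval_sub_left (gg_int hθ hθp _ _) (gg_int hθ hθp _ _)]
    have := intervalIntegral.integral_mono_on hxy (intervalIntegrable_const (c := m)) (gg_int hθ hθp x y)
      (fun t _ => hml t)
    simp at this
    linarith
  have T0 : T 0 = 0 := by simp [hT]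
  have hmono : StrictMono T := by
    intro x y hxy
    have := hdiff x y hxy.le
    have : 0 < m * (y - x) := mul_pos hm (by linarith)
    linarith
  have hsurj : Function.Surjective T := by
    refine hcont.surjective ?_ ?_
    · refine tendsto_atTop_mono' _ (f₁ := fun x => m * x) ?_ (tendsto_id.const_mul_atTop hm)
      filter_upwards [eventually_ge_atTop 0] with x hx
      have := hdiff 0 x hx
      simp [T0] at this; exact this
    · refine tendsto_atBot_mono' _ (f₁ := fun x => m * x) (f₂ := T) ?_ (tendsto_id.const_mul_atBot hm)
      filter_upwards [eventually_le_atBot 0] with x hx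
      have := hdiff x 0 hx
      simp [T0] at this; linarith
  refine ⟨hmono.orderIsoOfSurjective T hsurj, by simp [T0], fun s hs => ?_⟩
  rw [StrictMono.coe_orderIsoOfSurjective]
  have ev : ∀ᶠ u : ℝ in 𝓝 s, |u| < 1 := continuous_abs.continuousAt.eventually (gt_mem_nhds hs)
  have hg : gg p θ s = (GG p θ s)⁻¹ := by simp [gg, hs]
  have hca : ContinuousAt (gg p θ) s := by
    have : ContinuousAt (fun t => (GG p θ t)⁻¹) s := (GG_cont hθ hp).continuousAt.inv₀ (GG_pos hθ hp hs).ne'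
    refine this.congr ?_
    filter_upwards [ev] with u hu
    simp [gg, hu]
  rw [← hg]
  refine intervalIntegral.integral_hasDerivAt_right (gg_int hθ hθp _ _) ?_ hca
  refine ⟨univ, univ_mem, ?_⟩
  refine Measurable.aestronglyMeasurable ?_
  unfold gg
  refine Measurable.ite ?_ (GG_cont hθ (by linarith)).measurable.inv measurable_const
  exact measurableSet_lt (by fun_prop) (by fun_prop)

theorem profile {p θ : ℝ} (hθ : 1 < θ) (hθp : θ < p) : ∃ S : ℝ → ℝ, ∃ τ > 0,
    (∀ y, HasDerivAt S (GG p θ (S y)) y) ∧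
    (∀ y, HasDerivAt (fun x => GG p θ (S x) ^ (p - 1)) (F' θ (S y)) y) ∧
    (∀ y, |S y| ≤ 1) ∧ (∀ y, S y = 0 ↔ y = 0) ∧
    (∀ y, τ ≤ y → S y = 1) ∧ (∀ y, y ≤ -τ → S y = -1) := by
  have hp : 1 < p := by linarith
  obtain ⟨e, e0, he⟩ := gg_T hθ hθp
  set S : ℝ → ℝ := fun y => max (-1) (min 1 (e.symm y)) with hS
  have hSc : Continuous S := by
    have := e.symm.continuous
    fun_prop
  have hSb : ∀ y, |S y| ≤ 1 := fun y => abs_le.2 ⟨le_max_left _ _, max_le (by norm_num) (min_le_left _ _)⟩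
  have hS1 : ∀ y, e 1 ≤ y → S y = 1 := by
    intro y hy
    have : 1 ≤ e.symm y := e.le_symm_apply.2 hy
    simp [hS, this]
  have hS2 : ∀ y, y ≤ e (-1) → S y = -1 := by
    intro y hy
    have : e.symm y ≤ -1 := e.symm_apply_le.2 hy
    simp only [hS]
    rw [min_eq_right (by linarith), max_eq_left this]
  have hSi : ∀ y, e (-1) < y → y < e 1 → S y = e.symm y ∧ |S y| < 1 := by
    intro y h1 h2
    have h3 : -1 < e.symm y := e.lt_symm_apply.2 h1
    have h4 : e.symm y < 1 := e.symm_apply_lt.2 h2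
    have : S y = e.symm y := by
      simp only [hS]
      rw [min_eq_right h4.le, max_eq_right h3.le]
    exact ⟨this, by rw [this]; exact abs_lt.2 ⟨h3, h4⟩⟩
  have hGc := GG_cont hθ hp
  have em : e (-1) < 0 := by rw [← e0]; exact e.strictMono (by norm_num)
  have ep : 0 < e 1 := by rw [← e0]; exact e.strictMono (by norm_num)
  have hF'c : Continuous (fun y => F' θ (S y)) := by
    have : (fun y => F' θ (S y)) = fun y => -S y * (1 - S y ^ 2) ^ (θ - 1) := by
      ext y; exact F'_eq hθ (hSb y)
    rw [this]
    exact hSc.neg.mul (Continuous.rpow_const (by fun_prop) (fun x => Or.inr (by linarith)))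
  have hint : ∀ y, e (-1) < y → y < e 1 → HasDerivAt S (GG p θ (S y)) y := by
    intro y h1 h2
    obtain ⟨h3, h4⟩ := hSi y h1 h2
    have h5 := he (S y) h4
    rw [h3] at h5 h4
    have := HasDerivAt.of_local_left_inverse (f := e) (g := e.symm) (a := y) e.symm.continuous.continuousAt h5
      (inv_ne_zero (GG_pos hθ hp h4).ne') (Eventually.of_forall fun z => e.apply_symm_apply z)
    rw [inv_inv, ← h3] at this
    refine this.congr_of_eventuallyEq ?_
    filter_upwards [Ioo_mem_nhds h1 h2] with z hz using (hSi z hz.1 hz.2).1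
  have hc1 : ∀ y, e 1 < y → S =ᶠ[𝓝 y] fun _ => 1 := by
    intro y hy
    filter_upwards [Ioi_mem_nhds hy] with z hz using hS1 z (le_of_lt hz)
  have hc2 : ∀ y, y < e (-1) → S =ᶠ[𝓝 y] fun _ => -1 := by
    intro y hy
    filter_upwards [Iio_mem_nhds hy] with z hz using hS2 z (le_of_lt hz)
  have hcount : ({e (-1), e 1} : Set ℝ).Countable := (Set.toFinite _).countable
  have cases : ∀ y, y ∉ ({e (-1), e 1} : Set ℝ) → y < e (-1) ∨ e 1 < y ∨ (e (-1) < y ∧ y < e 1) := by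
    intro y hy
    simp only [mem_insert_iff, mem_singleton_iff, not_or] at hy
    rcases lt_or_gt_of_ne hy.1 with h | h
    · exact Or.inl h
    · rcases lt_or_gt_of_ne hy.2 with h' | h'
      · exact Or.inr (Or.inr ⟨h, h'⟩)
      · exact Or.inr (Or.inl h')
  have hd : ∀ y, HasDerivAt S (GG p θ (S y)) y := by
    refine deriv_fill hSc (hGc.comp hSc) hcount (fun y hy => ?_)
    rcases cases y hy with h | h | h
    · show HasDerivAt S (GG p θ (S y)) y
      rw [GG_one hθ hp (by rw [hS2 y h.le]; norm_num)]
      exact (hasDerivAt_const y (-1 : ℝ)).congr_of_eventuallyEq (hc2 y h)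
    · show HasDerivAt S (GG p θ (S y)) y
      rw [GG_one hθ hp (by rw [hS1 y h.le]; norm_num)]
      exact (hasDerivAt_const y (1 : ℝ)).congr_of_eventuallyEq (hc1 y h)
    · exact hint y h.1 h.2
  refine ⟨S, max (e 1) (-e (-1)), lt_max_of_lt_left ep, hd, ?_, hSb, ?_,
    fun y hy => hS1 y ((le_max_left _ _).trans hy), fun y hy => hS2 y ?_⟩
  · refine deriv_fill ((hGc.comp hSc).rpow_const (fun x => Or.inr (by linarith))) hF'c hcount (fun y hy => ?_)
    rcases cases y hy with h | h | h
    · rw [F'_one (by rw [hS2 y h.le]; norm_num)]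
      refine (hasDerivAt_const y (GG p θ (-1) ^ (p - 1))).congr_of_eventuallyEq ?_
      filter_upwards [hc2 y h] with z hz
      simp [hz]
    · rw [F'_one (by rw [hS1 y h.le]; norm_num)]
      refine (hasDerivAt_const y (GG p θ 1 ^ (p - 1))).congr_of_eventuallyEq ?_
      filter_upwards [hc1 y h] with z hz
      simp [hz]
    · have h4 := (hSi y h.1 h.2).2
      have := (GGp_deriv hθ hp h4).comp y (hd y)
      rw [div_mul_cancel₀ _ (GG_pos hθ hp h4).ne'] at this
      exact this
  · intro y
    constructor
    · intro h
      have h1 : e (-1) < y := by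
        by_contra hh
        rw [hS2 y (not_lt.1 hh)] at h; norm_num at h
      have h2 : y < e 1 := by
        by_contra hh
        rw [hS1 y (not_lt.1 hh)] at h; norm_num at h
      rw [(hSi y h1 h2).1] at h
      rw [← e.apply_symm_apply y, h, e0]
    · rintro rfl
      rw [(hSi 0 em ep).1, e.symm_apply_eq, e0]
  · have := le_max_right (e 1) (-e (-1))
    linarith

theorem local_form {p θ ε : ℝ} (hθ : 1 < θ) (hθp : θ < p) (hε : 0 < ε) {S φ : ℝ → ℝ}
    (hd : ∀ y, HasDerivAt S (GG p θ (S y)) y)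
    (hv : ∀ y, HasDerivAt (fun x => GG p θ (S x) ^ (p - 1)) (F' θ (S y)) y)
    (hloc : ∀ x, ∃ z c : ℝ, |c| = 1 ∧ φ =ᶠ[𝓝 x] fun y => c * S ((y - z) / ε)) :
    (∀ x, |deriv φ x| = GG p θ (φ x) / ε) ∧
    (∀ x, -(ε ^ p) * deriv (fun y => |deriv φ y| ^ (p - 2) * deriv φ y) x + F' θ (φ x) = 0) := by
  have hp : 1 < p := by linarith
  have hsub : ∀ z y : ℝ, HasDerivAt (fun y => (y - z) / ε) (1 / ε) y := fun z y =>
    ((hasDerivAt_id y).sub_const z).div_const ε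
  have hder : ∀ z c y : ℝ, HasDerivAt (fun y => c * S ((y - z) / ε))
      (c * (GG p θ (S ((y - z) / ε)) / ε)) y := by
    intro z c y
    have := ((hd ((y - z) / ε)).comp y (hsub z y)).const_mul c
    rw [mul_one_div] at this
    exact this
  have habs : ∀ {c : ℝ} (s : ℝ), |c| = 1 → GG p θ (c * s) = GG p θ s := by
    intro c s hc
    exact GG_congr (by rw [abs_mul, hc, one_mul])
  constructor
  · intro x
    obtain ⟨z, c, hc, h⟩ := hloc x
    rw [h.deriv_eq, (hder z c x).deriv, h.eq_of_nhds, habs _ hc, abs_mul, hc, one_mul,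
      abs_of_nonneg (div_nonneg (GG_nonneg hθ hp _) hε.le)]
  · intro x
    obtain ⟨z, c, hc, h⟩ := hloc x
    have hW : (fun y => |deriv φ y| ^ (p - 2) * deriv φ y) =ᶠ[𝓝 x]
        fun y => (c * (ε ^ (p - 1))⁻¹) * (GG p θ (S ((y - z) / ε)) ^ (p - 1)) := by
      filter_upwards [h.deriv] with y hy
      rw [hy, (hder z c y).deriv]
      have hg := GG_nonneg (p := p) hθ hp (S ((y - z) / ε))
      rw [abs_mul, hc, one_mul, abs_of_nonneg (div_nonneg hg hε.le)]
      have hr : 0 ≤ GG p θ (S ((y - z) / ε)) / ε := div_nonneg hg hε.le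
      have key : (GG p θ (S ((y - z) / ε)) / ε) ^ (p - 2) * (GG p θ (S ((y - z) / ε)) / ε) =
          (GG p θ (S ((y - z) / ε)) / ε) ^ (p - 1) := by
        rcases hr.eq_or_lt with h0 | h0
        · rw [← h0, mul_zero, Real.zero_rpow (by linarith)]
        · rw [show p - 1 = (p - 2) + 1 by ring, Real.rpow_add h0, Real.rpow_one]
      rw [show ∀ r g : ℝ, r * (c * g) = c * (r * g) by intros; ring, key, Real.div_rpow hg hε.le]
      ring
    have hWd := (((hv ((x - z) / ε)).comp x (hsub z x)).const_mul (c * (ε ^ (p - 1))⁻¹))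
    rw [hW.deriv_eq]
    have e : deriv (fun y => (c * (ε ^ (p - 1))⁻¹) * (GG p θ (S ((y - z) / ε)) ^ (p - 1))) x =
      c * (ε ^ (p - 1))⁻¹ * (F' θ (S ((x - z) / ε)) * (1 / ε)) := hWd.deriv
    rw [e, h.eq_of_nhds]
    have hF : F' θ (c * S ((x - z) / ε)) = c * F' θ (S ((x - z) / ε)) := by
      unfold F'
      have : c ^ 2 = 1 := by rw [← sq_abs, hc]; norm_num
      rw [mul_pow, this]; ring
    rw [hF]
    have he : ε ^ p = ε ^ (p - 1) * ε := by
      rw [show p = (p - 1) + 1 by ring, Real.rpow_add hε, Real.rpow_one]; ring_nf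
    rw [he]
    have : ε ^ (p - 1) ≠ 0 := (Real.rpow_pos_of_pos hε _).ne'
    field_simp
    ring

theorem one_energy {p θ ε τ a b z : ℝ} (hθ : 1 < θ) (hθp : θ < p) (hε : 0 < ε) {S : ℝ → ℝ}
    (hd : ∀ y, HasDerivAt S (GG p θ (S y)) y)
    (h1 : ∀ y, τ ≤ y → S y = 1) (h2 : ∀ y, y ≤ -τ → S y = -1)
    (ha : ε * τ < z - a) (hb : ε * τ < b - z) :
    ∫ x in a..b, GG p θ (S ((x - z) / ε)) ^ p / ε = cp p θ := by
  have hp : 1 < p := by linarith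
  have hGc := GG_cont hθ hp
  have hSc : Continuous S := continuous_iff_continuousAt.2 fun y => (hd y).continuousAt
  have hqc : Continuous (fun s => GG p θ s ^ (p - 1)) :=
    hGc.rpow_const (fun x => Or.inr (by linarith))
  have hsub : ∀ y : ℝ, HasDerivAt (fun y => (y - z) / ε) (1 / ε) y := fun y =>
    ((hasDerivAt_id y).sub_const z).div_const ε
  have hder : ∀ y : ℝ, HasDerivAt (fun y => S ((y - z) / ε))
      (GG p θ (S ((y - z) / ε)) / ε) y := by
    intro y
    have := ((hd ((y - z) / ε)).comp y (hsub y))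
    rw [mul_one_div] at this
    exact this
  have e : ∀ x, GG p θ (S ((x - z) / ε)) ^ p / ε =
      ((fun s => GG p θ s ^ (p - 1)) ∘ (fun y => S ((y - z) / ε))) x * (GG p θ (S ((x - z) / ε)) / ε) := by
    intro x
    have hg := GG_nonneg (p := p) hθ hp (S ((x - z) / ε))
    simp only [Function.comp]
    rcases hg.eq_or_lt with h0 | h0
    · rw [← h0, Real.zero_rpow (by linarith)]; simp
    · have hpp : ∀ g : ℝ, 0 < g → g ^ p = g ^ (p - 1) * g := by
        intro g hg
        conv_lhs => rw [show p = (p - 1) + 1 by ring]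
        rw [Real.rpow_add hg, Real.rpow_one]
      rw [hpp _ h0]; ring
  have hc2 : Continuous fun x => GG p θ (S ((x - z) / ε)) / ε := by
    have : Continuous fun x => S ((x - z) / ε) := by fun_prop
    exact (hGc.comp this).div_const _
  rw [intervalIntegral.integral_congr (fun x _ => e x),
    intervalIntegral.integral_comp_mul_deriv (fun x _ => hder x) hc2.continuousOn hqc,
    h2 ((a - z) / ε) (by rw [div_le_iff₀ hε]; linarith),
    h1 ((b - z) / ε) (by rw [le_div_iff₀ hε]; linarith)]
  unfold cp
  rw [← intervalIntegral.integral_const_mul]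
  refine intervalIntegral.integral_congr (fun s _ => ?_)
  have : 0 < p - 1 := by linarith
  rw [GG_pow hθ hp, Real.mul_rpow (by positivity) (F_nonneg' hθ s)]

theorem stmt2 (a b p θ : ℝ) (hab : a < b) (hθ : 1 < θ) (hθp : θ < p) (N : ℕ)
    (h : Fin N → ℝ) (hmono : StrictMono h) (hmem : ∀ i, h i ∈ Set.Ioo a b) :
    ∃ ε₀ > 0, ∀ ε ∈ Set.Ioo (0 : ℝ) ε₀, ∃ φ : ℝ → ℝ,
      solvesBVP a b p θ ε 0 φ ∧ solvesBVP a b p θ ε 0 (fun x => -φ x) ∧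
      (∀ x ∈ Set.Icc a b, |φ x| ≤ 1) ∧
      (∀ x ∈ Set.Icc a b, (φ x = 0 ↔ ∃ i, x = h i)) ∧
      Eeps a b p θ ε φ = N * cp p θ ∧
      Eeps a b p θ ε (fun x => -φ x) = N * cp p θ := by
  have hp : 1 < p := by linarith
  obtain ⟨S, τ, hτ, hd, hv, hSb, hS0, hS1, hS2⟩ := profile hθ hθp
  have small : ∀ r : ℝ, 0 < r → ∀ᶠ ε in 𝓝[>] (0 : ℝ), ε * τ < r := by
    intro r hr
    have : Tendsto (fun ε : ℝ => ε * τ) (𝓝[>] 0) (𝓝 0) := by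
      have : Continuous fun ε : ℝ => ε * τ := by fun_prop
      have := (this.tendsto 0).mono_left (nhdsWithin_le_nhds (s := Ioi 0))
      simpa using this
    exact this.eventually (gt_mem_nhds hr)
  have ev : ∀ᶠ ε in 𝓝[>] (0 : ℝ), (∀ i, ε * τ < h i - a) ∧ (∀ i, ε * τ < b - h i) ∧
      ∀ i j, i ≠ j → ε * τ < |h i - h j| / 2 := by
    refine (eventually_all.2 fun i => ?_).and ((eventually_all.2 fun i => ?_).and
      (eventually_all.2 fun i => eventually_all.2 fun j => ?_))
    · exact small _ (by linarith [(hmem i).1])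
    · exact small _ (by linarith [(hmem i).2])
    · by_cases hij : i = j
      · exact Eventually.of_forall fun _ hh => absurd hij hh
      · have : 0 < |h i - h j| := abs_pos.2 (sub_ne_zero.2 (hmono.injective.ne hij))
        exact (small _ (by linarith : 0 < |h i - h j| / 2)).mono fun _ hh _ => hh
  obtain ⟨ε₀, hε₀, hsubs⟩ := mem_nhdsGT_iff_exists_Ioo_subset.1 ev
  refine ⟨ε₀, hε₀, fun ε hεm => ?_⟩
  obtain ⟨hA, hB, hC⟩ := hsubs hεm
  have hε : 0 < ε := hεm.1
  -- each factor is `±1` and locally constant away from its zero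
  have far : ∀ z x, ε * τ < |x - z| → |S ((x - z) / ε)| = 1 ∧
      ∀ᶠ y in 𝓝 x, S ((y - z) / ε) = S ((x - z) / ε) := by
    intro z x hx
    rcases lt_abs.1 hx with h1 | h1
    · have k : ∀ y, ε * τ < y - z → S ((y - z) / ε) = 1 := fun y hy =>
        hS1 _ (by rw [le_div_iff₀ hε]; linarith)
      refine ⟨by rw [k x h1]; norm_num, ?_⟩
      filter_upwards [Ioi_mem_nhds (show z + ε * τ < x by linarith)] with y hy
      rw [k x h1, k y (by have : z + ε * τ < y := hy; linarith)]
    · have k : ∀ y, ε * τ < -(y - z) → S ((y - z) / ε) = -1 := fun y hy =>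
        hS2 _ (by rw [div_le_iff₀ hε]; linarith)
      refine ⟨by rw [k x h1]; norm_num, ?_⟩
      filter_upwards [Iio_mem_nhds (show x < z - ε * τ by linarith)] with y hy
      rw [k x h1, k y (by have : y < z - ε * τ := hy; linarith)]
  have sep : ∀ x i j, |x - h i| ≤ ε * τ → j ≠ i → ε * τ < |x - h j| := by
    intro x i j hi hij
    have h1 := hC j i hij
    have h2 := abs_sub_le (h j) x (h i)
    rw [abs_sub_comm (h j) x] at h2
    linarith
  set φ : ℝ → ℝ := fun x => ∏ i, S ((x - h i) / ε) with hφ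
  have hφsplit : ∀ i x, φ x = (∏ j ∈ Finset.univ.erase i, S ((x - h j) / ε)) * S ((x - h i) / ε) :=
    fun i x => (Finset.prod_erase_mul _ _ (Finset.mem_univ i)).symm
  have hloc : ∀ x, ∃ z c : ℝ, |c| = 1 ∧ φ =ᶠ[𝓝 x] fun y => c * S ((y - z) / ε) := by
    intro x
    by_cases hx : ∃ i, |x - h i| ≤ ε * τ
    · obtain ⟨i, hi⟩ := hx
      refine ⟨h i, ∏ j ∈ Finset.univ.erase i, S ((x - h j) / ε), ?_, ?_⟩
      · rw [Finset.abs_prod]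
        exact Finset.prod_eq_one fun j hj => (far _ _ (sep x i j hi (Finset.ne_of_mem_erase hj))).1
      · have : ∀ᶠ y in 𝓝 x, ∀ j, j ≠ i → S ((y - h j) / ε) = S ((x - h j) / ε) := by
          refine eventually_all.2 fun j => ?_
          by_cases hj : j = i
          · exact Eventually.of_forall fun _ hh => absurd hj hh
          · exact (far _ _ (sep x i j hi hj)).2.mono fun _ hh _ => hh
        filter_upwards [this] with y hy
        rw [hφsplit i y]
        congr 1
        exact Finset.prod_congr rfl fun j hj => hy j (Finset.ne_of_mem_erase hj)
    · push Not at hx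
      refine ⟨x - ε * (τ + 1), φ x, ?_, ?_⟩
      · simp only [hφ]
        rw [Finset.abs_prod]
        exact Finset.prod_eq_one fun j _ => (far _ _ (hx j)).1
      · have : ∀ᶠ y in 𝓝 x, ∀ j, S ((y - h j) / ε) = S ((x - h j) / ε) :=
          eventually_all.2 fun j => (far _ _ (hx j)).2
        filter_upwards [this, Ioi_mem_nhds (show x - ε < x by linarith)] with y hy hy2
        have hy3 : x - ε < y := hy2
        rw [hS1 _ (by rw [le_div_iff₀ hε]; nlinarith), mul_one]
        exact Finset.prod_congr rfl fun j _ => hy j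
  have hloc' : ∀ x, ∃ z c : ℝ, |c| = 1 ∧ (fun x => -φ x) =ᶠ[𝓝 x] fun y => c * S ((y - z) / ε) := by
    intro x
    obtain ⟨z, c, hc, he⟩ := hloc x
    refine ⟨z, -c, by rw [abs_neg, hc], ?_⟩
    filter_upwards [he] with y hy
    rw [hy]; ring
  obtain ⟨hD, hE⟩ := local_form hθ hθp hε hd hv hloc
  obtain ⟨hD', hE'⟩ := local_form hθ hθp hε hd hv hloc'
  have hend : ∀ x, (∀ i, ε * τ < |x - h i|) → GG p θ (φ x) = 0 := by
    intro x hx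
    refine GG_one hθ hp ?_
    simp only [hφ]
    rw [Finset.abs_prod]
    exact Finset.prod_eq_one fun j _ => (far _ _ (hx j)).1
  have hGa : GG p θ (φ a) = 0 := hend a fun i => by
    rw [abs_sub_comm]; exact (hA i).trans_le (le_abs_self _)
  have hGb : GG p θ (φ b) = 0 := hend b fun i => (hB i).trans_le (le_abs_self _)
  have hneg : ∀ x, GG p θ (-φ x) = GG p θ (φ x) := fun x => GG_congr (abs_neg _)
  have hsum : ∀ x, GG p θ (φ x) ^ p = ∑ i, GG p θ (S ((x - h i) / ε)) ^ p := by
    intro x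
    have z0 : (0 : ℝ) ^ p = 0 := Real.zero_rpow (by linarith)
    by_cases hx : ∃ i, |x - h i| ≤ ε * τ
    · obtain ⟨i, hi⟩ := hx
      rw [Finset.sum_eq_single i]
      · congr 1
        refine GG_congr ?_
        rw [hφsplit i x, abs_mul, Finset.abs_prod, Finset.prod_eq_one, one_mul]
        exact fun j hj => (far _ _ (sep x i j hi (Finset.ne_of_mem_erase hj))).1
      · intro j _ hj
        rw [GG_one hθ hp (far _ _ (sep x i j hi hj)).1, z0]
      · intro hh; exact absurd (Finset.mem_univ i) hh
    · push Not at hx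
      rw [hend x hx, z0]
      exact (Finset.sum_eq_zero fun j _ => by rw [GG_one hθ hp (far _ _ (hx j)).1, z0]).symm
  have hSc : Continuous S := continuous_iff_continuousAt.2 fun y => (hd y).continuousAt
  have energy : ∀ u : ℝ → ℝ, (∀ x, |deriv u x| = GG p θ (u x) / ε) →
      (∀ x, GG p θ (u x) = GG p θ (φ x)) → Eeps a b p θ ε u = N * cp p θ := by
    intro u hu1 hu2
    unfold Eeps
    have e : ∀ x, ε ^ (p - 1) * |deriv u x| ^ p / p + F θ (u x) / ε =
        ∑ i, GG p θ (S ((x - h i) / ε)) ^ p / ε := by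
      intro x
      have h0 : 0 < p - 1 := by linarith
      have hg := GG_nonneg (p := p) hθ hp (u x)
      have hFG : F θ (u x) = (p - 1) / p * GG p θ (u x) ^ p := by
        rw [GG_pow hθ hp, div_self (by linarith), Real.rpow_one]
        field_simp
      have he : ε ^ p = ε ^ (p - 1) * ε := by
        rw [show p = (p - 1) + 1 by ring, Real.rpow_add hε, Real.rpow_one]; ring_nf
      have hne : ε ^ (p - 1) ≠ 0 := (Real.rpow_pos_of_pos hε _).ne'
      rw [← Finset.sum_div, ← hsum, ← hu2, hu1, hFG, Real.div_rpow hg hε.le, he]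
      field_simp
      ring
    rw [intervalIntegral.integral_congr (fun x _ => e x), intervalIntegral.integral_finsetSum]
    · rw [Finset.sum_congr rfl fun i _ => one_energy hθ hθp hε hd hS1 hS2 (hA i) (hB i)]
      simp
    · intro i _
      refine Continuous.intervalIntegrable ?_ _ _
      have : Continuous fun x => S ((x - h i) / ε) := by fun_prop
      exact (((GG_cont hθ hp).comp this).rpow_const fun x => Or.inr (by linarith)).div_const _
  refine ⟨φ, ⟨fun x _ => hE x, ?_, ?_⟩, ⟨fun x _ => hE' x, ?_, ?_⟩, ?_, ?_, ?_, ?_⟩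
  · exact abs_eq_zero.1 (by rw [hD, hGa, zero_div])
  · exact abs_eq_zero.1 (by rw [hD, hGb, zero_div])
  · exact abs_eq_zero.1 (by rw [hD', hneg, hGa, zero_div])
  · exact abs_eq_zero.1 (by rw [hD', hneg, hGb, zero_div])
  · intro x _
    simp only [hφ]
    rw [Finset.abs_prod]
    exact Finset.prod_le_one (fun _ _ => abs_nonneg _) fun _ _ => hSb _
  · intro x _
    simp only [hφ]
    rw [Finset.prod_eq_zero_iff]
    simp [hS0, hε.ne', sub_eq_zero]
  · exact energy _ hD fun _ => rfl
  · exact energy _ hD' hneg
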